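/- Suppose ρ₁ ≠ ρ₂, ρ₁⁻¹ and ρ₂⁻¹ are integers divisible by p, and c'' = c/(ρ₁⁻¹ − ρ₂⁻¹) = c₁/c₂ ∈ E_a with integers c₁, c₂, gcd(c₁, c₂) = 1, where c₂ = p^ℓ·m for some ℓ ∈ ℕ and integer m with p ∤ m. If p^{ℓ+1} does not divide ρ₁⁻¹ − ρ₂⁻¹, then μ_{M̃,D̃} is not a spectral measure. -/

import Mathlib

open MeasureTheory Complex Matrix
open scoped ENNReal

noncomputable section

/-- The exponential function `e_λ(x) = e^{-2πi⟨λ,x⟩}` on `ℝ²`. -/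
def expChar (lam x : Fin 2 → ℝ) : ℂ :=
  Complex.exp ((-2 * Real.pi * Complex.I) * ((lam 0 * x 0 + lam 1 * x 1 : ℝ) : ℂ))

/-- The Fourier transform `μ̂(ξ) = ∫ e^{-2πi⟨ξ,x⟩} dμ(x)` of a measure on `ℝ²`. -/
def ftMeasure (μ : Measure (Fin 2 → ℝ)) (ξ : Fin 2 → ℝ) : ℂ :=
  ∫ x, expChar ξ x ∂μ

/-- The mask `m_D(ξ) = (1/p) Σ_{d∈D} e^{-2πi⟨ξ,d⟩}` of a digit system `D : Fin p → ℝ²`. -/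
def mask {p : ℕ} (D : Fin p → (Fin 2 → ℝ)) (ξ : Fin 2 → ℝ) : ℂ :=
  (p : ℂ)⁻¹ * ∑ i : Fin p, expChar ξ (D i)

/-- Integer digits, coerced to real vectors. -/
def digitR {p : ℕ} (D : Fin p → (Fin 2 → ℤ)) : Fin p → (Fin 2 → ℝ) :=
  fun i j => (D i j : ℝ)

/-- `μ` is the self-affine measure of the IFS `φ_d(x) = M⁻¹(x+d)`, `d ∈ D`:
a compactly supported Borel probability measure with `μ = (1/#D) Σ_d μ ∘ φ_d⁻¹`. -/
def IsSelfAffine {p : ℕ} (μ : Measure (Fin 2 → ℝ)) (M : Matrix (Fin 2) (Fin 2) ℝ)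
    (D : Fin p → (Fin 2 → ℝ)) : Prop :=
  IsProbabilityMeasure μ ∧ (∃ K : Set (Fin 2 → ℝ), IsCompact K ∧ μ Kᶜ = 0) ∧
  μ = (p : ℝ≥0∞)⁻¹ • ∑ i : Fin p, μ.map (fun x => M⁻¹.mulVec (x + D i))

/-- `Λ` is an orthogonal set of exponentials for `μ`. -/
def IsOrthoSet (μ : Measure (Fin 2 → ℝ)) (Λ : Set (Fin 2 → ℝ)) : Prop :=
  ∀ l ∈ Λ, ∀ l' ∈ Λ, l ≠ l' → ftMeasure μ (l - l') = 0

/-- `μ` is a spectral measure: some countable set of exponentials forms an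
orthonormal (Hilbert) basis of `L²(μ)`. -/
def IsSpectral (μ : Measure (Fin 2 → ℝ)) : Prop :=
  ∃ Λ : Set (Fin 2 → ℝ), Λ.Countable ∧
    ∃ b : HilbertBasis Λ ℂ (Lp ℂ 2 μ),
      ∀ lam : Λ, ⇑(b lam) =ᵐ[μ] expChar (lam : Fin 2 → ℝ)

/-- The standing assumption on the digit set: `a = (a₁,a₂)` has entries in `[1,p-1]`
and `Z(m_D) = ⋃_{j=1}^{p-1} (j·a/p + ℤ²)`. -/
def ZeroSetCond (p : ℕ) (D : Fin p → (Fin 2 → ℤ)) (a : Fin 2 → ℤ) : Prop :=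
  (∀ i, 1 ≤ a i ∧ a i ≤ (p : ℤ) - 1) ∧
  ∀ ξ : Fin 2 → ℝ, mask (digitR D) ξ = 0 ↔
    ∃ j : ℕ, 1 ≤ j ∧ j ≤ p - 1 ∧ ∃ k : Fin 2 → ℤ,
      ∀ i, ξ i = (j : ℝ) * (a i : ℝ) / p + (k i : ℝ)

/-- The upper-triangular expanding matrix `M = [[ρ₁⁻¹, c],[0, ρ₂⁻¹]]`. -/
def Mupper (ρ₁ ρ₂ c : ℝ) : Matrix (Fin 2) (Fin 2) ℝ := !![ρ₁⁻¹, c; 0, ρ₂⁻¹]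

/-- The set `E_a = {h/l : gcd(h,l)=1, l·a₂ − h·a₁ ∈ ℤ∖pℤ} ∪ {0}`. -/
def Ea (p : ℕ) (a : Fin 2 → ℤ) : Set ℝ :=
  {x | ∃ h l : ℤ, Int.gcd h l = 1 ∧ ¬ ((p : ℤ) ∣ (l * a 1 - h * a 0)) ∧
    x = (h : ℝ) / (l : ℝ)} ∪ {0}


lemma expChar_norm (l x : Fin 2 → ℝ) : ‖expChar l x‖ = 1 := by
  unfold expChar
  have : (-2 * (Real.pi:ℂ) * Complex.I) * ((l 0 * x 0 + l 1 * x 1 : ℝ) : ℂ)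
      = ((-2 * Real.pi * (l 0 * x 0 + l 1 * x 1) : ℝ) : ℂ) * Complex.I := by
    push_cast; ring
  rw [this, Complex.norm_exp_ofReal_mul_I]

lemma expChar_conj (l x : Fin 2 → ℝ) : (starRingEnd ℂ) (expChar l x) = expChar (-l) x := by
  unfold expChar
  rw [← Complex.exp_conj]
  congr 1
  simp only [map_mul, Complex.conj_I, Complex.conj_ofReal, map_neg, map_ofNat, Pi.neg_apply]
  push_cast; ring

lemma expChar_add_left (l l' x : Fin 2 → ℝ) :
    expChar (l + l') x = expChar l x * expChar l' x := by
  unfold expChar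
  rw [← Complex.exp_add]
  congr 1
  simp only [Pi.add_apply]
  push_cast; ring

lemma expChar_add_right (l x y : Fin 2 → ℝ) :
    expChar l (x + y) = expChar l x * expChar l y := by
  unfold expChar
  rw [← Complex.exp_add]
  congr 1
  simp only [Pi.add_apply]
  push_cast; ring

lemma expChar_continuous (l : Fin 2 → ℝ) : Continuous (expChar l) := by
  unfold expChar; fun_prop

lemma expChar_continuous' (x : Fin 2 → ℝ) : Continuous (fun l => expChar l x) := by
  unfold expChar; fun_prop

lemma expChar_memLp (μ : Measure (Fin 2 → ℝ)) [IsProbabilityMeasure μ] (l : Fin 2 → ℝ) :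
    MemLp (expChar l) 2 μ :=
  MemLp.of_bound (expChar_continuous l).aestronglyMeasurable 1
    (Filter.Eventually.of_forall fun x => (expChar_norm l x).le)

lemma expChar_integrable (μ : Measure (Fin 2 → ℝ)) [IsProbabilityMeasure μ] (l : Fin 2 → ℝ) :
    Integrable (expChar l) μ :=
  (expChar_memLp μ l).integrable (by norm_num)

lemma ftMeasure_continuous (μ : Measure (Fin 2 → ℝ)) [IsProbabilityMeasure μ] :
    Continuous (ftMeasure μ) := by
  unfold ftMeasure
  refine continuous_of_dominated (bound := fun _ => 1) ?_ ?_ (integrable_const 1) ?_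
  · exact fun l => (expChar_continuous l).aestronglyMeasurable
  · exact fun l => Filter.Eventually.of_forall fun x => (expChar_norm l x).le
  · exact Filter.Eventually.of_forall fun x => expChar_continuous' x

lemma expChar_zero (x : Fin 2 → ℝ) : expChar 0 x = 1 := by simp [expChar]

lemma ftMeasure_zero (μ : Measure (Fin 2 → ℝ)) [IsProbabilityMeasure μ] :
    ftMeasure μ 0 = 1 := by
  simp [ftMeasure, expChar_zero]

lemma inner_of_ae (μ : Measure (Fin 2 → ℝ)) (f g : Lp ℂ 2 μ)
    (l l' : Fin 2 → ℝ) (hf : f =ᵐ[μ] expChar l) (hg : g =ᵐ[μ] expChar l') :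
    inner ℂ f g = ftMeasure μ (l' - l) := by
  rw [L2.inner_def, ftMeasure]
  refine integral_congr_ae ?_
  filter_upwards [hf, hg] with x hx hy
  rw [hx, hy, RCLike.inner_apply, expChar_conj, sub_eq_add_neg, expChar_add_left]

/-- The comparison criterion. -/
lemma spectral_compare (μ ν : Measure (Fin 2 → ℝ)) [IsProbabilityMeasure μ]
    [IsProbabilityMeasure ν] (Λ : Set (Fin 2 → ℝ)) (b : HilbertBasis Λ ℂ (Lp ℂ 2 μ))
    (hb : ∀ lam : Λ, ⇑(b lam) =ᵐ[μ] expChar (lam : Fin 2 → ℝ))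
    (ho : IsOrthoSet ν Λ) (hle : ∀ ξ, ‖ftMeasure μ ξ‖ ≤ ‖ftMeasure ν ξ‖)
    (η : Fin 2 → ℝ) (hη : ‖ftMeasure μ η‖ < ‖ftMeasure ν η‖) : False := by
  have pars : ∀ ξ : Fin 2 → ℝ, HasSum (fun l : Λ => ‖ftMeasure μ (l - ξ)‖ ^ 2) 1 := by
    intro ξ
    let f : Lp ℂ 2 μ := (expChar_memLp μ ξ).toLp _
    have hf : f =ᵐ[μ] expChar ξ := MemLp.coeFn_toLp _
    have h := b.hasSum_inner_mul_inner f f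
    rw [inner_of_ae μ f f ξ ξ hf hf, sub_self, ftMeasure_zero] at h
    have h2 := Complex.hasSum_re h
    rw [Complex.one_re] at h2
    convert h2 using 1
    funext l
    rw [← inner_conj_symm (b l) f, inner_of_ae μ f (b l) ξ l hf (hb l), Complex.mul_conj,
      Complex.ofReal_re, Complex.normSq_eq_norm_sq]
  have bess : ∀ ξ : Fin 2 → ℝ, ∀ s : Finset Λ, ∑ l ∈ s, ‖ftMeasure ν (l - ξ)‖ ^ 2 ≤ 1 := by
    intro ξ s
    let f : Lp ℂ 2 ν := (expChar_memLp ν ξ).toLp _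
    have hf : f =ᵐ[ν] expChar ξ := MemLp.coeFn_toLp _
    let v : Λ → Lp ℂ 2 ν := fun l => (expChar_memLp ν l).toLp _
    have hv : ∀ l : Λ, v l =ᵐ[ν] expChar l := fun l => MemLp.coeFn_toLp _
    have hon : Orthonormal ℂ v := by
      classical
      rw [orthonormal_iff_ite]
      intro i j
      rw [inner_of_ae ν _ _ i j (hv i) (hv j)]
      split_ifs with h
      · rw [h, sub_self, ftMeasure_zero]
      · exact ho j j.2 i i.2 (fun h' => h (Subtype.ext h'.symm))
    have h := hon.sum_inner_products_le (s := s) f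
    have hff : ‖f‖ ^ 2 = 1 := by
      have := inner_self_eq_norm_sq (𝕜 := ℂ) f
      rw [inner_of_ae ν f f ξ ξ hf hf, sub_self, ftMeasure_zero] at this
      simpa using this.symm
    rw [hff] at h
    refine le_trans (le_of_eq ?_) h
    refine Finset.sum_congr rfl fun l _ => ?_
    rw [← inner_of_ae ν f (v l) ξ l hf (hv l), norm_inner_symm]
  have hne : Nonempty Λ := by
    by_contra hcon
    rw [not_nonempty_iff] at hcon
    have h1 := pars 0
    have h2 := h1.unique hasSum_empty
    norm_num at h2
  obtain ⟨l0⟩ := hne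
  set ξ : Fin 2 → ℝ := l0 - η with hξ
  have hl0 : (l0 : Fin 2 → ℝ) - ξ = η := by rw [hξ]; abel
  have hsum : Summable (fun l : Λ => ‖ftMeasure ν (l - ξ)‖ ^ 2) :=
    summable_of_sum_le (fun _ => by positivity) (bess ξ)
  have hlt : ∑' l : Λ, ‖ftMeasure μ (l - ξ)‖ ^ 2 < ∑' l : Λ, ‖ftMeasure ν (l - ξ)‖ ^ 2 := by
    refine Summable.tsum_lt_tsum (i := l0) ?_ ?_ (pars ξ).summable hsum
    · intro l
      exact pow_le_pow_left₀ (norm_nonneg _) (hle _) 2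
    · rw [hl0]
      exact pow_lt_pow_left₀ hη (norm_nonneg _) (by norm_num)
  rw [(pars ξ).tsum_eq] at hlt
  have := hsum.tsum_le_of_sum_le (bess ξ)
  linarith

lemma ft_avg {p : ℕ} (μ : Measure (Fin 2 → ℝ)) [IsProbabilityMeasure μ]
    (F : Fin p → (Fin 2 → ℝ) → (Fin 2 → ℝ)) (hF : ∀ i, Continuous (F i)) (ξ : Fin 2 → ℝ) :
    ftMeasure ((p : ℝ≥0∞)⁻¹ • ∑ i : Fin p, μ.map (F i)) ξ
      = (p : ℂ)⁻¹ * ∑ i : Fin p, ∫ x, expChar ξ (F i x) ∂μ := by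
  have hpr : ∀ i, IsProbabilityMeasure (μ.map (F i)) :=
    fun i => Measure.isProbabilityMeasure_map (hF i).aemeasurable
  unfold ftMeasure
  rw [integral_smul_measure, integral_finsetSum_measure]
  · rw [Complex.real_smul]
    congr 1
    · simp
    · refine Finset.sum_congr rfl fun i _ => ?_
      rw [integral_map (hF i).aemeasurable (expChar_continuous ξ).aestronglyMeasurable]
  · intro i _
    exact expChar_integrable _ ξ

lemma prob_avg {p : ℕ} (hp : p ≠ 0) (μ : Measure (Fin 2 → ℝ)) [IsProbabilityMeasure μ]
    (F : Fin p → (Fin 2 → ℝ) → (Fin 2 → ℝ)) (hF : ∀ i, Continuous (F i)) :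
    IsProbabilityMeasure ((p : ℝ≥0∞)⁻¹ • ∑ i : Fin p, μ.map (F i)) := by
  have hpr : ∀ i, IsProbabilityMeasure (μ.map (F i)) :=
    fun i => Measure.isProbabilityMeasure_map (hF i).aemeasurable
  constructor
  simp only [Measure.smul_apply, Measure.finsetSum_apply, measure_univ, Finset.sum_const,
    Finset.card_univ, Fintype.card_fin, smul_eq_mul, nsmul_eq_mul, mul_one]
  exact ENNReal.inv_mul_cancel (by exact_mod_cast hp) (ENNReal.natCast_ne_top p)

/-- The diagonal contraction. -/
def dil (r s : ℝ) (x : Fin 2 → ℝ) : Fin 2 → ℝ := ![r * x 0, s * x 1]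

lemma dil_continuous (r s : ℝ) : Continuous (dil r s) := by
  unfold dil
  refine continuous_pi fun i => ?_
  fin_cases i
  · simp; fun_prop
  · simp; fun_prop

lemma expChar_dil (r s : ℝ) (ξ x : Fin 2 → ℝ) : expChar ξ (dil r s x) = expChar (dil r s ξ) x := by
  unfold expChar dil
  congr 2
  simp
  ring

lemma mask_norm_le {p : ℕ} (D : Fin p → (Fin 2 → ℝ)) (ξ : Fin 2 → ℝ) : ‖mask D ξ‖ ≤ 1 := by
  unfold mask
  rw [norm_mul, norm_inv, Complex.norm_natCast]
  have h : ‖∑ i : Fin p, expChar ξ (D i)‖ ≤ p := by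
    refine (norm_sum_le _ _).trans ?_
    simp [expChar_norm]
  calc (p:ℝ)⁻¹ * ‖∑ i : Fin p, expChar ξ (D i)‖ ≤ (p:ℝ)⁻¹ * p := by gcongr
    _ ≤ 1 := inv_mul_le_one

lemma ft_dil (r s : ℝ) (μ : Measure (Fin 2 → ℝ)) (ξ : Fin 2 → ℝ) :
    ftMeasure (μ.map (dil r s)) ξ = ftMeasure μ (dil r s ξ) := by
  unfold ftMeasure
  rw [integral_map (dil_continuous r s).aemeasurable (expChar_continuous ξ).aestronglyMeasurable]
  simp only [expChar_dil]

/-- Measure with second factor skipped. -/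
def skipTwo {p : ℕ} (r s : ℝ) (μ : Measure (Fin 2 → ℝ)) (D : Fin p → (Fin 2 → ℝ)) :
    Measure (Fin 2 → ℝ) :=
  (p : ℝ≥0∞)⁻¹ • ∑ i : Fin p, μ.map (fun x => dil r s (dil r s x) + dil r s (D i))

lemma ft_skipTwo {p : ℕ} (r s : ℝ) (μ : Measure (Fin 2 → ℝ)) [IsProbabilityMeasure μ]
    (D : Fin p → (Fin 2 → ℝ)) (ξ : Fin 2 → ℝ) :
    ftMeasure (skipTwo r s μ D) ξ
      = mask D (dil r s ξ) * ftMeasure μ (dil r s (dil r s ξ)) := by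
  unfold skipTwo
  rw [ft_avg μ _ (fun i => by
    exact ((dil_continuous r s).comp (dil_continuous r s)).add continuous_const)]
  simp only [expChar_add_right, expChar_dil, integral_mul_const]
  rw [← Finset.mul_sum, mask, ftMeasure]
  ring

lemma ft_selfAffine {p : ℕ} (r s : ℝ) (hr : r ≠ 0) (hs : s ≠ 0) (μ : Measure (Fin 2 → ℝ))
    (D : Fin p → (Fin 2 → ℝ)) (h : IsSelfAffine μ !![r⁻¹, 0; 0, s⁻¹] D) (ξ : Fin 2 → ℝ) :
    ftMeasure μ ξ = mask D (dil r s ξ) * ftMeasure μ (dil r s ξ) := by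
  obtain ⟨h1, -, h3⟩ := h
  have hinv : (!![r⁻¹, 0; 0, s⁻¹] : Matrix (Fin 2) (Fin 2) ℝ)⁻¹ = !![r, 0; 0, s] := by
    apply Matrix.inv_eq_right_inv
    ext i j
    fin_cases i <;> fin_cases j <;> simp [hr, hs]
  have hmap : ∀ x, (!![r⁻¹, 0; 0, s⁻¹] : Matrix (Fin 2) (Fin 2) ℝ)⁻¹.mulVec x = dil r s x := by
    intro x
    rw [hinv]
    ext i
    fin_cases i <;> simp [dil, Matrix.mulVec, dotProduct, Fin.sum_univ_two]
  simp only [hmap] at h3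
  conv_lhs => rw [h3]
  rw [ft_avg μ _ (fun i => by
    exact (dil_continuous r s).comp (continuous_id.add continuous_const))]
  simp only [expChar_dil, expChar_add_right, integral_mul_const]
  rw [← Finset.mul_sum, mask, ftMeasure]
  ring

lemma dil_iter (r s : ℝ) (n : ℕ) (ξ : Fin 2 → ℝ) :
    (dil r s)^[n] ξ = dil (r ^ n) (s ^ n) ξ := by
  induction n with
  | zero => ext i; fin_cases i <;> simp [dil]
  | succ n ih =>
    rw [Function.iterate_succ_apply', ih]
    ext i; fin_cases i <;> simp [dil] <;> ring

/-- zeros come from a mask factor -/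
lemma zero_factor (g m : (Fin 2 → ℝ) → ℂ) (r s : ℝ) (hr0 : 0 < r) (hr1 : r < 1)
    (hs0 : 0 < s) (hs1 : s < 1) (hg : Continuous g) (hg0 : g 0 = 1)
    (hrec : ∀ ξ, g ξ = m (dil r s ξ) * g (dil r s ξ)) (ξ : Fin 2 → ℝ) (h0 : g ξ = 0) :
    ∃ n : ℕ, m (dil (r ^ (n + 1)) (s ^ (n + 1)) ξ) = 0 := by
  by_contra! hcon
  have hall : ∀ n : ℕ, g (dil (r ^ n) (s ^ n) ξ) = 0 := by
    intro n
    rw [← dil_iter]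
    induction n with
    | zero => simpa using h0
    | succ n ih =>
      rw [hrec, ← Function.iterate_succ_apply' (dil r s) n ξ] at ih
      have := hcon n
      rw [← dil_iter] at this
      exact (mul_eq_zero.mp ih).resolve_left this
  have hlim : Filter.Tendsto (fun n : ℕ => dil (r ^ n) (s ^ n) ξ) Filter.atTop (nhds 0) := by
    rw [tendsto_pi_nhds]
    intro i
    have hr := (tendsto_pow_atTop_nhds_zero_of_lt_one hr0.le hr1).mul_const (ξ 0)
    have hs := (tendsto_pow_atTop_nhds_zero_of_lt_one hs0.le hs1).mul_const (ξ 1)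
    rw [zero_mul] at hr hs
    fin_cases i
    · simpa [dil] using hr
    · simpa [dil] using hs
  have h1 := (hg.tendsto 0).comp hlim
  have h2 : (g ∘ fun n : ℕ => dil (r ^ n) (s ^ n) ξ) = fun _ => 0 := funext hall
  rw [h2, hg0] at h1
  exact one_ne_zero (tendsto_nhds_unique h1 tendsto_const_nhds)

/-- The `n`-th layer of the zero set. -/
def ZN (p : ℕ) (a : Fin 2 → ℤ) (t₁ t₂ : ℤ) (q : ℝ) (n : ℕ) (ξ : Fin 2 → ℝ) : Prop :=
  ∃ j k0 k1 : ℤ, ¬ (p : ℤ) ∣ j ∧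
    ξ 0 = (t₁ : ℝ) ^ n * (((j * a 0 + p * k0 : ℤ) : ℝ) / p) ∧
    ξ 1 = (t₂ : ℝ) ^ n * (((j * a 1 + p * k1 : ℤ) : ℝ) / p
      - q * (((j * a 0 + p * k0 : ℤ) : ℝ) / p))

/-- The subgroup of points whose functional value lies in `p^(s+1) ℤ`. -/
def phiS (p : ℕ) (c₁ c₂ : ℤ) (s : ℕ) (ξ : Fin 2 → ℝ) : Prop :=
  ∃ w : ℤ, (p : ℝ) * (c₁ * ξ 0 + c₂ * ξ 1) = ((p : ℤ) ^ (s + 1) * w : ℤ)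

lemma phiS.add {p : ℕ} {c₁ c₂ : ℤ} {s : ℕ} {x y : Fin 2 → ℝ} (hx : phiS p c₁ c₂ s x)
    (hy : phiS p c₁ c₂ s y) : phiS p c₁ c₂ s (x + y) := by
  obtain ⟨w, hw⟩ := hx
  obtain ⟨v, hv⟩ := hy
  refine ⟨w + v, ?_⟩
  push_cast at hw hv ⊢
  simp only [Pi.add_apply]
  linear_combination hw + hv

lemma phiS.sub {p : ℕ} {c₁ c₂ : ℤ} {s : ℕ} {x y : Fin 2 → ℝ} (hx : phiS p c₁ c₂ s x)
    (hy : phiS p c₁ c₂ s y) : phiS p c₁ c₂ s (x - y) := by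
  obtain ⟨w, hw⟩ := hx
  obtain ⟨v, hv⟩ := hy
  refine ⟨w - v, ?_⟩
  push_cast at hw hv ⊢
  simp only [Pi.sub_apply]
  linear_combination hw - hv

lemma ZN_dil (p : ℕ) (a : Fin 2 → ℤ) (t₁ t₂ : ℤ) (q : ℝ) (n : ℕ) (r s : ℝ)
    (hr : r * t₁ = 1) (hs : s * t₂ = 1) (ξ : Fin 2 → ℝ) :
    ZN p a t₁ t₂ q 0 (dil (r ^ n) (s ^ n) ξ) ↔ ZN p a t₁ t₂ q n ξ := by
  have h1 : r ^ n * (t₁ : ℝ) ^ n = 1 := by rw [← mul_pow, hr, one_pow]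
  have h2 : s ^ n * (t₂ : ℝ) ^ n = 1 := by rw [← mul_pow, hs, one_pow]
  have key : ∀ A B x y : ℝ, A * B = 1 → (A * x = B ^ 0 * y ↔ x = B * y) := by
    intro A B x y h
    constructor
    · intro h'
      linear_combination (-x) * h + B * h'
    · rintro rfl
      linear_combination y * h
  unfold ZN
  refine exists_congr fun j => exists_congr fun k0 => exists_congr fun k1 =>
    and_congr_right fun _ => ?_
  have e1 := key (r ^ n) (t₁ ^ n) (ξ 0) (((j * a 0 + p * k0 : ℤ) : ℝ) / p) h1
  have e2 := key (s ^ n) (t₂ ^ n) (ξ 1) (((j * a 1 + p * k1 : ℤ) : ℝ) / p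
      - q * (((j * a 0 + p * k0 : ℤ) : ℝ) / p)) h2
  rw [← e1, ← e2]
  simp [dil]

lemma ZN_exists (p : ℕ) (hpp : Prime (p : ℤ)) (a : Fin 2 → ℤ) (t₁ t₂ : ℤ) (q : ℝ) (n : ℕ) :
    ∃ η, ZN p a t₁ t₂ q n η :=
  ⟨![_, _], 1, 0, 0, fun h => hpp.not_isUnit (isUnit_of_dvd_one h), rfl, rfl⟩

lemma mask_zero_iff (p : ℕ) (hp : p.Prime) (D : Fin p → (Fin 2 → ℤ)) (a : Fin 2 → ℤ)
    (hZ : ZeroSetCond p D a) (q : ℝ) (Dt : Fin p → (Fin 2 → ℝ))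
    (hDt : ∀ i, Dt i = ![(D i 0 : ℝ) + q * (D i 1 : ℝ), (D i 1 : ℝ)]) (ξ : Fin 2 → ℝ) :
    ∀ {t₁ t₂ : ℤ}, mask Dt ξ = 0 ↔ ZN p a t₁ t₂ q 0 ξ := by
  intro t₁ t₂
  have hpR : (p : ℝ) ≠ 0 := by exact_mod_cast hp.ne_zero
  have h1 : mask Dt ξ = mask (digitR D) ![ξ 0, q * ξ 0 + ξ 1] := by
    unfold mask
    congr 1
    refine Finset.sum_congr rfl fun i _ => ?_
    rw [hDt]
    unfold expChar digitR
    congr 2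
    simp
    ring
  rw [h1, hZ.2]
  constructor
  · rintro ⟨j, hj1, hj2, k, hk⟩
    have e0 := hk 0
    have e1 := hk 1
    simp only [Matrix.cons_val_zero, Matrix.cons_val_one] at e0 e1
    refine ⟨j, k 0, k 1, ?_, ?_, ?_⟩
    · intro h
      have h' : p ∣ j := by exact_mod_cast h
      have := Nat.le_of_dvd (by omega) h'
      have := hp.pos
      omega
    · rw [e0]; push_cast; field_simp
    · have : ξ 1 = j * a 1 / p + k 1 - q * ξ 0 := by linarith
      rw [this, e0]; push_cast; field_simp
  · rintro ⟨j, k0, k1, hj, e0, e1⟩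
    have hp0 : (p : ℤ) ≠ 0 := by exact_mod_cast hp.ne_zero
    have hpos : (0 : ℤ) < p := by exact_mod_cast hp.pos
    have hnn := Int.emod_nonneg j hp0
    have hlt := Int.emod_lt_of_pos j hpos
    have hne : j % p ≠ 0 := fun h => hj (Int.dvd_of_emod_eq_zero h)
    have hdm := Int.emod_add_mul_ediv j p
    obtain ⟨r, hr⟩ : ∃ r : ℕ, (r : ℤ) = j % p := ⟨(j % p).toNat, Int.toNat_of_nonneg hnn⟩
    rw [← hr] at hdm hlt hne
    set d := j / (p : ℤ)
    refine ⟨r, by omega, by omega, ![k0 + d * a 0, k1 + d * a 1], ?_⟩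
    intro i
    fin_cases i
    · simp only [Fin.zero_eta, Matrix.cons_val_zero]
      rw [e0, ← hdm]; push_cast; field_simp; ring
    · simp only [Fin.mk_one, Matrix.cons_val_one]
      rw [e1, e0, ← hdm]; push_cast; field_simp; ring

lemma phi_val (p : ℕ) (hp0 : (p : ℝ) ≠ 0) (c₁ c₂ t₁ t₂ : ℤ) (hc : (c₂ : ℝ) ≠ 0) (n : ℕ) (X Y : ℤ)
    (x y : ℝ) (h0 : x = (t₁ : ℝ) ^ n * ((X : ℝ) / p))
    (h1 : y = (t₂ : ℝ) ^ n * ((Y : ℝ) / p - c₁ / c₂ * ((X : ℝ) / p))) :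
    (p : ℝ) * (c₁ * x + c₂ * y) = ((c₁ * (t₁ ^ n - t₂ ^ n) * X + c₂ * t₂ ^ n * Y : ℤ) : ℝ) := by
  rw [h0, h1]
  push_cast
  field_simp
  ring

lemma not_dvd_X {p : ℕ} (hpp : Prime (p : ℤ)) {j α k : ℤ} (hj : ¬ (p : ℤ) ∣ j)
    (ha : ¬ (p : ℤ) ∣ α) : ¬ (p : ℤ) ∣ j * α + p * k := by
  intro h
  have h2 : (p : ℤ) ∣ j * α := (dvd_add_left (dvd_mul_right _ _)).mp h
  rcases hpp.dvd_or_dvd h2 with h | h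
  · exact hj h
  · exact ha h

lemma cancel_dvd {p : ℤ} (hpp : Prime p) {n : ℕ} {u v w : ℤ} (hu : ¬ p ∣ u) (hw : ¬ p ∣ w)
    (h : p ^ n ∣ u * v * w) : p ^ n ∣ v := by
  have h1 := hpp.pow_dvd_of_dvd_mul_right n hw h
  exact hpp.pow_dvd_of_dvd_mul_left n hu h1

lemma phi_one (p : ℕ) (hpp : Prime (p : ℤ)) (a : Fin 2 → ℤ) (t₁ t₂ c₁ c₂ : ℤ) (hc20 : c₂ ≠ 0)
    (ℓ s : ℕ) (hsl : s ≤ ℓ) (hlc : (p : ℤ) ^ ℓ ∣ c₂) (hpc1 : ¬ (p : ℤ) ∣ c₁)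
    (hpa : ∀ i, ¬ (p : ℤ) ∣ a i) (hpt₂ : (p : ℤ) ∣ t₂) (_hs1 : (p : ℤ) ^ s ∣ t₁ - t₂)
    (hs2 : ¬ (p : ℤ) ^ (s + 1) ∣ t₁ - t₂) (ξ : Fin 2 → ℝ)
    (h : ZN p a t₁ t₂ (c₁ / c₂) 1 ξ) : ¬ phiS p c₁ c₂ s ξ := by
  rintro ⟨w, hw⟩
  obtain ⟨j, k0, k1, hj, h0, h1⟩ := h
  have hp0 : (p : ℝ) ≠ 0 := by exact_mod_cast hpp.ne_zero
  rw [phi_val p hp0 c₁ c₂ t₁ t₂ (by exact_mod_cast hc20) 1 _ _ _ _ h0 h1, Int.cast_inj] at hw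
  simp only [pow_one] at hw
  have hd : (p : ℤ) ^ (s + 1) ∣ c₂ * t₂ :=
    (pow_dvd_pow _ (by omega)).trans (pow_succ (p : ℤ) ℓ ▸ mul_dvd_mul hlc hpt₂)
  have hd2 : (p : ℤ) ^ (s + 1) ∣ c₁ * (t₁ - t₂) * (j * a 0 + p * k0) :=
    (dvd_add_left (hd.mul_right _)).mp ⟨w, hw⟩
  exact hs2 (cancel_dvd hpp hpc1 (not_dvd_X hpp hj (hpa 0)) hd2)

lemma phi_two (p : ℕ) (hpp : Prime (p : ℤ)) (a : Fin 2 → ℤ) (t₁ t₂ c₁ c₂ : ℤ) (hc20 : c₂ ≠ 0)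
    (ℓ s : ℕ) (hsl : s ≤ ℓ) (hlc : (p : ℤ) ^ ℓ ∣ c₂) (hpt₁ : (p : ℤ) ∣ t₁)
    (hpt₂ : (p : ℤ) ∣ t₂) (hs1 : (p : ℤ) ^ s ∣ t₁ - t₂) (n : ℕ) (hn : 2 ≤ n) (ξ : Fin 2 → ℝ)
    (h : ZN p a t₁ t₂ (c₁ / c₂) n ξ) : phiS p c₁ c₂ s ξ := by
  obtain ⟨j, k0, k1, hj, h0, h1⟩ := h
  have hp0 : (p : ℝ) ≠ 0 := by exact_mod_cast hpp.ne_zero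
  have hd : (p : ℤ) ^ (s + 1) ∣ c₂ * t₂ ^ n :=
    (pow_dvd_pow _ (by omega)).trans
      (pow_succ (p : ℤ) ℓ ▸ mul_dvd_mul hlc (hpt₂.trans (dvd_pow_self _ (by omega))))
  have hd2 : (p : ℤ) ^ (s + 1) ∣ t₁ ^ n - t₂ ^ n := by
    obtain ⟨n, rfl⟩ : ∃ k, n = k + 1 := ⟨n - 1, by omega⟩
    have e : t₁ ^ (n + 1) - t₂ ^ (n + 1) = (t₁ - t₂) * t₁ ^ n + (t₁ ^ n - t₂ ^ n) * t₂ := by ring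
    rw [e, pow_succ]
    refine dvd_add (mul_dvd_mul hs1 (hpt₁.trans (dvd_pow_self _ (by omega))))
      (mul_dvd_mul (hs1.trans (sub_dvd_pow_sub_pow _ _ _)) hpt₂)
  have hd3 : (p : ℤ) ^ (s + 1) ∣ c₁ * (t₁ ^ n - t₂ ^ n) * (j * a 0 + p * k0)
      + c₂ * t₂ ^ n * (j * a 1 + p * k1) :=
    dvd_add ((hd2.mul_left _).mul_right _) (hd.mul_right _)
  obtain ⟨w, hw⟩ := hd3
  refine ⟨w, ?_⟩
  rw [phi_val p hp0 c₁ c₂ t₁ t₂ (by exact_mod_cast hc20) n _ _ _ _ h0 h1, hw]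

lemma no_two (p : ℕ) (hpp : Prime (p : ℤ)) (a : Fin 2 → ℤ) (t₁ t₂ c₁ c₂ : ℤ) (hc20 : c₂ ≠ 0)
    (ℓ s : ℕ) (hsl : s ≤ ℓ) (hlc : (p : ℤ) ^ ℓ ∣ c₂) (hpc1 : ¬ (p : ℤ) ∣ c₁)
    (hpa : ∀ i, ¬ (p : ℤ) ∣ a i) (hpt₁ : (p : ℤ) ∣ t₁) (hpt₂ : (p : ℤ) ∣ t₂)
    (hs2 : ¬ (p : ℤ) ^ (s + 1) ∣ t₁ - t₂) (ht1 : t₁ ≠ 0) (ht2 : t₂ ≠ 0)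
    (x y : Fin 2 → ℝ) (hx : ZN p a t₁ t₂ (c₁ / c₂) 1 x) (hy : ZN p a t₁ t₂ (c₁ / c₂) 1 y)
    (hxy : ZN p a t₁ t₂ (c₁ / c₂) 2 (x - y)) : False := by
  obtain ⟨j, k0, k1, hj, hx0, hx1⟩ := hx
  obtain ⟨j', k0', k1', hj', hy0, hy1⟩ := hy
  obtain ⟨i, n0, n1, hi, hz0, hz1⟩ := hxy
  have hp0 : (p : ℝ) ≠ 0 := by exact_mod_cast hpp.ne_zero
  have ht1R : (t₁ : ℝ) ≠ 0 := by exact_mod_cast ht1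
  have ht2R : (t₂ : ℝ) ≠ 0 := by exact_mod_cast ht2
  have hcR : (c₂ : ℝ) ≠ 0 := by exact_mod_cast hc20
  rw [Pi.sub_apply, hx0, hy0] at hz0
  rw [Pi.sub_apply, hx1, hy1] at hz1
  have hX'' := not_dvd_X (k := n0) hpp hi (hpa 0)
  generalize hX : j * a 0 + p * k0 = X at *
  generalize hY : j * a 1 + p * k1 = Y at *
  generalize hX' : j' * a 0 + p * k0' = X' at *
  generalize hY' : j' * a 1 + p * k1' = Y' at *
  generalize hU : i * a 0 + p * n0 = U at *
  generalize hV : i * a 1 + p * n1 = V at *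
  have e0 : X - X' = t₁ * U := by
    field_simp at hz0
    have h : (t₁ : ℝ) * (X - X') = t₁ * (t₁ * U) := by linear_combination (t₁ : ℝ) * hz0
    have h2 := mul_left_cancel₀ ht1R h
    exact_mod_cast h2
  have e1 : c₂ * (Y - Y') - c₁ * (X - X') = t₂ * (c₂ * V - c₁ * U) := by
    field_simp at hz1
    have h : (t₂ : ℝ) * (c₂ * (Y - Y') - c₁ * (X - X')) = t₂ * (t₂ * (c₂ * V - c₁ * U)) := by
      linear_combination (t₂ : ℝ) * hz1
    have h2 := mul_left_cancel₀ ht2R h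
    exact_mod_cast h2
  have hjj : (p : ℤ) ∣ j - j' := by
    have h1 : (p : ℤ) ∣ (j - j') * a 0 := by
      have : (j - j') * a 0 = t₁ * U - p * (k0 - k0') := by rw [← e0, ← hX, ← hX']; ring
      rw [this]
      exact dvd_sub (hpt₁.mul_right _) (dvd_mul_right _ _)
    exact (hpp.dvd_or_dvd h1).resolve_right (hpa 0)
  have hYY : (p : ℤ) ∣ Y - Y' := by
    have : Y - Y' = (j - j') * a 1 + p * (k1 - k1') := by rw [← hY, ← hY']; ring
    rw [this]
    exact dvd_add (hjj.mul_right _) (dvd_mul_right _ _)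
  have hfin : c₁ * (t₁ - t₂) * U = c₂ * (Y - Y') - c₂ * t₂ * V := by
    linear_combination (-1) * e1 - c₁ * e0
  have hd : (p : ℤ) ^ (s + 1) ∣ c₁ * (t₁ - t₂) * U := by
    refine (pow_dvd_pow _ (Nat.succ_le_succ hsl)).trans ?_
    rw [hfin, pow_succ]
    exact dvd_sub (mul_dvd_mul hlc hYY) ((mul_dvd_mul hlc hpt₂).mul_right _)
  exact hs2 (cancel_dvd hpp hpc1 hX'' hd)

/-- Proposition 5.2: with `ρ₁⁻¹ = t₁, ρ₂⁻¹ = t₂ ∈ pℤ` and `c'' = c₁/c₂ ∈ E_a`,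
`gcd(c₁,c₂)=1`, `c₂ = p^ℓ·m`, `p ∤ m`, if `p^{ℓ+1} ∤ (t₁ − t₂)` then `μ_{M̃,D̃}` is not
a spectral measure. -/
theorem stmt15 (p : ℕ) (hp : p.Prime) (ρ₁ ρ₂ c : ℝ)
    (hρ10 : 0 < ρ₁) (hρ11 : ρ₁ < 1) (hρ20 : 0 < ρ₂) (hρ21 : ρ₂ < 1) (hρ : ρ₁ ≠ ρ₂)
    (D : Fin p → (Fin 2 → ℤ)) (hD : Function.Injective D)
    (a : Fin 2 → ℤ) (hZ : ZeroSetCond p D a)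
    (hD0 : D ⟨0, hp.pos⟩ = 0)
    (hD11 : D ⟨1, hp.one_lt⟩ 1 = 0) (hD10 : D ⟨1, hp.one_lt⟩ 0 ≠ 0)
    (t₁ t₂ : ℤ) (ht₁ : ρ₁⁻¹ = (t₁ : ℝ)) (ht₂ : ρ₂⁻¹ = (t₂ : ℝ))
    (hpt₁ : (p : ℤ) ∣ t₁) (hpt₂ : (p : ℤ) ∣ t₂)
    (c₁ c₂ : ℤ) (hc₁c₂ : Int.gcd c₁ c₂ = 1) (ℓ : ℕ) (m : ℤ)
    (hc₂ : c₂ = (p : ℤ) ^ ℓ * m) (hm : ¬ (p : ℤ) ∣ m)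
    (hc'' : c / (ρ₁⁻¹ - ρ₂⁻¹) = (c₁ : ℝ) / (c₂ : ℝ))
    (hE : c / (ρ₁⁻¹ - ρ₂⁻¹) ∈ Ea p a)
    (Mt : Matrix (Fin 2) (Fin 2) ℝ) (hMt : Mt = !![ρ₁⁻¹, 0; 0, ρ₂⁻¹])
    (Dt : Fin p → (Fin 2 → ℝ))
    (hDt : ∀ i, Dt i = ![(D i 0 : ℝ) + (c / (ρ₁⁻¹ - ρ₂⁻¹)) * (D i 1 : ℝ), (D i 1 : ℝ)])
    (μt : Measure (Fin 2 → ℝ)) (hμt : IsSelfAffine μt Mt Dt)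
    (hndvd : ¬ (p : ℤ) ^ (ℓ + 1) ∣ (t₁ - t₂)) :
    ¬ IsSpectral μt := by
  classical
  have hpp : Prime (p : ℤ) := Nat.prime_iff_prime_int.mp hp
  have hpR : (p : ℝ) ≠ 0 := by exact_mod_cast hp.ne_zero
  -- the exponent s
  obtain ⟨s, hsl, hs1, hs2⟩ : ∃ s : ℕ, s ≤ ℓ ∧ (p : ℤ) ^ s ∣ t₁ - t₂ ∧
      ¬ (p : ℤ) ^ (s + 1) ∣ t₁ - t₂ := by
    have hex : ∃ e : ℕ, ¬ (p : ℤ) ^ (e + 1) ∣ t₁ - t₂ := ⟨ℓ, hndvd⟩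
    refine ⟨Nat.find hex, Nat.find_min' hex hndvd, ?_, Nat.find_spec hex⟩
    rcases hfe : Nat.find hex with _ | e
    · simp
    · have := Nat.find_min hex (m := e) (by omega)
      exact not_not.mp this
  have hs0 : 1 ≤ s := by
    by_contra hcon
    have : s = 0 := by omega
    subst this
    exact hs2 (by simpa using dvd_sub hpt₁ hpt₂)
  have hm0 : m ≠ 0 := fun h => hm (h ▸ dvd_zero _)
  have hc20 : c₂ ≠ 0 := by
    rw [hc₂]; exact mul_ne_zero (pow_ne_zero _ hpp.ne_zero) hm0
  have hlc : (p : ℤ) ^ ℓ ∣ c₂ := ⟨m, hc₂⟩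
  have hpc1 : ¬ (p : ℤ) ∣ c₁ := by
    intro h
    have h2 : (p : ℤ) ∣ c₂ := (dvd_pow_self _ (by omega)).trans hlc
    have := Int.dvd_coe_gcd h h2
    rw [hc₁c₂] at this
    exact hpp.not_isUnit (isUnit_of_dvd_one (by simpa using this))
  have hpa : ∀ i, ¬ (p : ℤ) ∣ a i := by
    intro i h
    obtain ⟨h1, h2⟩ := hZ.1 i
    have := Int.le_of_dvd (by omega) h
    omega
  have hr1 : ρ₁ * t₁ = 1 := by rw [← ht₁]; exact mul_inv_cancel₀ hρ10.ne'
  have hr2 : ρ₂ * t₂ = 1 := by rw [← ht₂]; exact mul_inv_cancel₀ hρ20.ne'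
  rw [hc''] at hDt
  rw [hMt] at hμt
  have hmask := mask_zero_iff p hp D a hZ (c₁ / c₂) Dt hDt
  have hZN : ∀ n ξ, mask Dt (dil (ρ₁ ^ n) (ρ₂ ^ n) ξ) = 0 ↔ ZN p a t₁ t₂ (c₁ / c₂) n ξ :=
    fun n ξ => by rw [hmask]; exact ZN_dil p a t₁ t₂ _ n ρ₁ ρ₂ hr1 hr2 ξ
  have hφ1 := phi_one p hpp a t₁ t₂ c₁ c₂ hc20 ℓ s hsl hlc hpc1 hpa hpt₂ hs1 hs2
  have hφ2 := phi_two p hpp a t₁ t₂ c₁ c₂ hc20 ℓ s hsl hlc hpt₁ hpt₂ hs1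
  have := hμt.1
  set g := ftMeasure μt with hgdef
  set A := dil ρ₁ ρ₂ with hA
  have hrec : ∀ ξ, g ξ = mask Dt (A ξ) * g (A ξ) :=
    ft_selfAffine ρ₁ ρ₂ hρ10.ne' hρ20.ne' μt Dt hμt
  have hAn : ∀ n ξ, dil (ρ₁ ^ n) (ρ₂ ^ n) (A ξ) = dil (ρ₁ ^ (n + 1)) (ρ₂ ^ (n + 1)) ξ := by
    intro n ξ
    rw [← dil_iter, ← dil_iter, Function.iterate_succ_apply]
  have hZ1 : ∀ ξ, mask Dt (A ξ) = 0 ↔ ZN p a t₁ t₂ (c₁ / c₂) 1 ξ := by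
    intro ξ; rw [← hZN, pow_one, pow_one]
  have hZ2 : ∀ ξ, mask Dt (A (A ξ)) = 0 ↔ ZN p a t₁ t₂ (c₁ / c₂) 2 ξ := by
    intro ξ
    rw [← hZN 2, ← hAn 1, pow_one, pow_one]
  have hzero : ∀ ξ, g ξ = 0 → ∃ n : ℕ, ZN p a t₁ t₂ (c₁ / c₂) (n + 1) ξ := by
    intro ξ h0
    obtain ⟨n, hn⟩ := zero_factor g (mask Dt) ρ₁ ρ₂ hρ10 hρ11 hρ20 hρ21
      (ftMeasure_continuous μt) (ftMeasure_zero μt) hrec ξ h0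
    exact ⟨n, (hZN _ _).mp hn⟩
  -- witnesses
  obtain ⟨η1, hη1⟩ : ∃ η, ZN p a t₁ t₂ (c₁ / c₂) 1 η := ZN_exists p hpp a _ _ _ 1
  obtain ⟨η2, hη2⟩ : ∃ η, ZN p a t₁ t₂ (c₁ / c₂) 2 η := ZN_exists p hpp a _ _ _ 2
  have hgA : ∀ η, ZN p a t₁ t₂ (c₁ / c₂) 1 η → g (A η) ≠ 0 := by
    intro η hη h0
    obtain ⟨n, hn⟩ := hzero _ h0
    rw [← hZN, hAn, hZN] at hn
    exact hφ1 _ hη (hφ2 (n + 1 + 1) (by omega) _ hn)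
  rintro ⟨Λ, -, b, hb⟩
  have hoμ : ∀ l ∈ Λ, ∀ l' ∈ Λ, l ≠ l' → g (l - l') = 0 := by
    intro l hl l' hl' hne
    rw [hgdef, ← inner_of_ae μt (b ⟨l', hl'⟩) (b ⟨l, hl⟩) l' l (hb _) (hb _)]
    exact b.orthonormal.2 (fun h => hne (congrArg Subtype.val h).symm)
  by_cases hcase : ∀ l ∈ Λ, ∀ l' ∈ Λ, ¬ ZN p a t₁ t₂ (c₁ / c₂) 1 (l - l')
  · have hpr : IsProbabilityMeasure (μt.map A) :=
      Measure.isProbabilityMeasure_map (dil_continuous _ _).aemeasurable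
    refine spectral_compare μt (μt.map A) Λ b hb ?_ ?_ η1 ?_
    · intro l hl l' hl' hne
      have h := hoμ l hl l' hl' hne
      rw [hrec] at h
      rw [hA, ft_dil]
      exact (mul_eq_zero.mp h).resolve_left (fun h' => hcase l hl l' hl' ((hZ1 _).mp h'))
    · intro ξ
      rw [hA, ft_dil, ← hgdef, ← hA, hrec, norm_mul]
      exact mul_le_of_le_one_left (norm_nonneg _) (mask_norm_le _ _)
    · rw [hA, ft_dil, ← hgdef, ← hA, hrec, (hZ1 _).mpr hη1, zero_mul, norm_zero]
      exact norm_pos_iff.mpr (hgA _ hη1)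
  · have hno2 : ∀ l ∈ Λ, ∀ l' ∈ Λ, ¬ ZN p a t₁ t₂ (c₁ / c₂) 2 (l - l') := by
      push Not at hcase
      obtain ⟨u, hu, v, hv, huv⟩ := hcase
      intro l hl l' hl' hll
      -- any nonzero φ-class difference lies in Z_1
      have hone : ∀ x ∈ Λ, ∀ y ∈ Λ, ¬ phiS p c₁ c₂ s (x - y) →
          ZN p a t₁ t₂ (c₁ / c₂) 1 (x - y) := by
        intro x hx y hy hxy
        have hne : x ≠ y := by
          rintro rfl
          exact hxy ⟨0, by simp⟩
        obtain ⟨n, hn⟩ := hzero _ (hoμ x hx y hy hne)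
        rcases n with _ | n
        · exact hn
        · exact absurd (hφ2 _ (by omega) _ hn) hxy
      have hllS := hφ2 2 le_rfl _ hll
      obtain ⟨w, hw, hlw⟩ : ∃ w ∈ Λ, ¬ phiS p c₁ c₂ s (l - w) := by
        by_contra! hcon
        refine hφ1 _ huv ?_
        have := (hcon v hv).sub (hcon u hu)
        convert this using 1
        abel
      have hlw' : ¬ phiS p c₁ c₂ s (l' - w) := by
        intro h
        refine hlw ?_
        have := hllS.add h
        convert this using 1
        abel
      exact no_two p hpp a t₁ t₂ c₁ c₂ hc20 ℓ s hsl hlc hpc1 hpa hpt₁ hpt₂ hs2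
        (by rintro rfl; simp at hr1) (by rintro rfl; simp at hr2) (l - w) (l' - w)
        (hone _ hl _ hw hlw) (hone _ hl' _ hw hlw') (by simpa using hll)
    have hpr : IsProbabilityMeasure (skipTwo ρ₁ ρ₂ μt Dt) :=
      prob_avg hp.ne_zero μt _ (fun i => by
        exact ((dil_continuous _ _).comp (dil_continuous _ _)).add continuous_const)
    have hft : ∀ ξ, ftMeasure (skipTwo ρ₁ ρ₂ μt Dt) ξ = mask Dt (A ξ) * g (A (A ξ)) :=
      ft_skipTwo ρ₁ ρ₂ μt Dt
    have hrec2 : ∀ ξ, g ξ = mask Dt (A (A ξ)) * (mask Dt (A ξ) * g (A (A ξ))) := by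
      intro ξ
      rw [hrec, hrec (A ξ)]; ring
    refine spectral_compare μt (skipTwo ρ₁ ρ₂ μt Dt) Λ b hb ?_ ?_ η2 ?_
    · intro l hl l' hl' hne
      have h := hoμ l hl l' hl' hne
      rw [hrec2] at h
      rw [hft]
      exact (mul_eq_zero.mp h).resolve_left (fun h' => hno2 l hl l' hl' ((hZ2 _).mp h'))
    · intro ξ
      rw [hft, ← hgdef, hrec2, norm_mul]
      exact mul_le_of_le_one_left (norm_nonneg _) (mask_norm_le _ _)
    · rw [hft, ← hgdef, hrec2, (hZ2 _).mpr hη2, zero_mul, norm_zero]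
      refine norm_pos_iff.mpr (mul_ne_zero ?_ (hgA _ ?_))
      · intro h
        exact hφ1 _ ((hZ1 _).mp h) (hφ2 2 le_rfl _ hη2)
      · exact (hZ1 _).mp ((hZ2 _).mpr hη2)

end
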